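/- arXiv:0810.0801 — 3 statements merged into one kernel-verified Lean document; each statement's English description precedes it below -/
import Mathlib

section
/- For the toroidal 3³.4² lattice S^t(n,2m), the energy per vertex converges as n, m → ∞ (jointly, i.e., along the product filter): lim_{n,m→∞} E(S^t(n,2m))/(2nm) = (1/(8π²)) ∫₀^{2π} ∫₀^{2π} ( |2cos x + sqrt(3 + 2cos x + 2cos y + 2cos(x+y))| + |2cos x − sqrt(3 + 2cos x + 2cos y + 2cos(x+y))| ) dx dy. -/
open Real Filter SimpleGraph

/-- The adjacency matrix of a simple graph over `ℝ` is Hermitian (it is symmetric). -/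
lemma adjMatrix_isHermitian {V : Type*} [Fintype V] [DecidableEq V]
    (G : SimpleGraph V) [DecidableRel G.Adj] : (G.adjMatrix ℝ).IsHermitian := by
  unfold Matrix.IsHermitian
  rw [Matrix.conjTranspose_eq_transpose_of_trivial]
  exact G.isSymm_adjMatrix

/-- The eigenvalues (with multiplicity, indexed by the vertices) of the adjacency
matrix of a finite simple graph, regarded as a real symmetric matrix. -/
noncomputable def graphEigenvalues {V : Type*} [Fintype V] [DecidableEq V]
    (G : SimpleGraph V) : V → ℝ :=
  letI := Classical.decRel G.Adj
  (adjMatrix_isHermitian G).eigenvalues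

/-- The energy of a finite simple graph: the sum of the absolute values of the
eigenvalues (with multiplicity) of its adjacency matrix. -/
noncomputable def graphEnergy {V : Type*} [Fintype V] [DecidableEq V]
    (G : SimpleGraph V) : ℝ :=
  ∑ v, |graphEigenvalues G v|

/-- The toroidal `3³.4²` lattice `S^t(n,2m)`: the simple graph on
`(ℤ/nℤ) × (ℤ/mℤ) × {0,1}` in which `(i,j,0)` is adjacent to `(i,j,1)`,
`(i,j−1,1)` and `(i±1,j,0)`, and `(i,j,1)` is adjacent additionally to
`(i±1,j,1)` and to `(i−1,j,0)`. -/
def sqTriTorus (n m : ℕ) : SimpleGraph (ZMod n × ZMod m × Bool) :=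
  SimpleGraph.fromRel fun u v =>
    (u.2.2 = false ∧ v.2.2 = true ∧ v.1 = u.1 ∧ v.2.1 = u.2.1) ∨
      (u.2.2 = false ∧ v.2.2 = true ∧ v.1 = u.1 ∧ v.2.1 = u.2.1 - 1) ∨
      (u.2.2 = false ∧ v.2.2 = false ∧ v.1 = u.1 + 1 ∧ v.2.1 = u.2.1) ∨
      (u.2.2 = true ∧ v.2.2 = true ∧ v.1 = u.1 + 1 ∧ v.2.1 = u.2.1) ∨
      (u.2.2 = true ∧ v.2.2 = false ∧ v.1 = u.1 - 1 ∧ v.2.1 = u.2.1)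

/-- The energy of `S^t(n,2m)` as a function of `n, m` (junk value `0` when
`n = 0` or `m = 0`, where `ℤ/nℤ` is infinite). -/
noncomputable def sqTriTorusEnergy : ℕ → ℕ → ℝ
  | 0, _ => 0
  | _ + 1, 0 => 0
  | n + 1, m + 1 => graphEnergy (sqTriTorus (n + 1) (m + 1))

lemma graphEnergy_eq_of_eigenvectors {V : Type*} [Fintype V] [DecidableEq V]
    (G : SimpleGraph V) (P : Matrix V V ℂ) (d : V → ℝ) {c : ℂ} (hc : c ≠ 0)
    (horth : P.conjTranspose * P = c • 1)
    (heig : ∀ (_ : DecidableRel G.Adj) (u w : V),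
      ∑ v ∈ G.neighborFinset u, P v w = d w * P u w) :
    graphEnergy G = ∑ w, |d w| := by
  let _ := Classical.decRel G.Adj
  have hPinv : (c⁻¹ • P.conjTranspose) * P = 1 := by
    rw [Matrix.smul_mul, horth, smul_smul, inv_mul_cancel₀ hc, one_smul]
  let U : (Matrix V V ℂ)ˣ :=
    ⟨P, c⁻¹ • P.conjTranspose, mul_eq_one_comm.mp hPinv, hPinv⟩
  have hmul : G.adjMatrix ℂ * P = P * Matrix.diagonal (fun w => (d w : ℂ)) := by
    ext u w
    rw [Matrix.mul_diagonal, SimpleGraph.adjMatrix_mul_apply, heig, mul_comm]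
  have hconj : G.adjMatrix ℂ = U * Matrix.diagonal (fun w => (d w : ℂ)) * (U⁻¹ : _) := by
    rw [Units.eq_mul_inv_iff_mul_eq]
    exact hmul
  have hmap : (G.adjMatrix ℝ).map Complex.ofRealHom = G.adjMatrix ℂ := by
    ext u v
    simp [SimpleGraph.adjMatrix_apply, apply_ite]
  have hchar : (G.adjMatrix ℝ).charpoly = (Matrix.diagonal d).charpoly := by
    apply Polynomial.map_injective Complex.ofRealHom Complex.ofReal_injective
    rw [← Matrix.charpoly_map, ← Matrix.charpoly_map, hmap, hconj, Matrix.coe_units_inv,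
      Matrix.charpoly_units_conj]
    rw [Matrix.diagonal_map (map_zero _)]
    rfl
  have hroots := (adjMatrix_isHermitian G).roots_charpoly_eq_eigenvalues
  have hroots' := Polynomial.roots_multiset_prod_X_sub_C (Finset.univ.val.map d)
  rw [Multiset.map_map] at hroots'
  rw [hchar, Matrix.charpoly_diagonal] at hroots
  replace hroots := hroots'.symm.trans hroots
  have := congrArg (fun s : Multiset ℝ => (s.map abs).sum) hroots
  simp only [Multiset.map_map] at this
  exact this.symm

lemma abs_riemannSum_sub_integral_le {f : ℝ → ℝ} (hf : Continuous f) {L ε : ℝ} (hL : 0 ≤ L)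
    {n : ℕ} (hn : 0 < n)
    (h : ∀ x ∈ Set.Icc 0 L, ∀ y ∈ Set.Icc 0 L, |x - y| ≤ L / n → |f x - f y| ≤ ε) :
    |L / n * ∑ k ∈ Finset.range n, f (L / n * k) - ∫ x in (0 : ℝ)..L, f x| ≤ L * ε := by
  have hn' : (0 : ℝ) < n := by exact_mod_cast hn
  have hδ : 0 ≤ L / n := by positivity
  have hsplit := intervalIntegral.sum_integral_adjacent_intervals (f := f)
    (μ := MeasureTheory.volume) (a := fun k : ℕ => L / n * k) (n := n)
    (fun k _ => hf.intervalIntegrable _ _)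
  simp only [Nat.cast_zero, mul_zero, div_mul_cancel₀ L hn'.ne'] at hsplit
  rw [← hsplit, Finset.mul_sum, ← Finset.sum_sub_distrib]
  calc _ ≤ ∑ k ∈ Finset.range n, ε * (L / n) := by
        refine (Finset.abs_sum_le_sum_abs _ _).trans (Finset.sum_le_sum fun k hk => ?_)
        have hk' : (k : ℝ) + 1 ≤ n := by exact_mod_cast Finset.mem_range.mp hk
        have hup : L / n * (k + 1) ≤ L := by
          calc L / n * (k + 1) ≤ L / n * n := by gcongr
            _ = L := div_mul_cancel₀ L hn'.ne'
        have hlen : L / n * ((k + 1 : ℕ) : ℝ) - L / n * k = L / n := by push_cast; ring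
        have hconst : L / n * f (L / n * k) =
            ∫ _ in (L / n * k)..(L / n * ((k + 1 : ℕ) : ℝ)), f (L / n * k) := by
          rw [intervalIntegral.integral_const, hlen, smul_eq_mul]
        rw [hconst, ← intervalIntegral.integral_sub (by simp) (hf.intervalIntegrable _ _)]
        have hb := intervalIntegral.norm_integral_le_of_norm_le_const (C := ε)
          (f := fun x => f (L / n * k) - f x)
          (a := L / n * k) (b := L / n * ((k + 1 : ℕ) : ℝ)) ?_
        · rwa [hlen, abs_of_nonneg hδ] at hb
        · intro x hx
          rw [Set.uIoc_of_le (by linarith), Set.mem_Ioc] at hx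
          have h0 : 0 ≤ L / n * (k : ℝ) := by positivity
          push_cast at hx
          refine h _ ⟨h0, by linarith⟩ _ ⟨by linarith, by linarith⟩ ?_
          rw [abs_le]
          constructor <;> linarith
    _ = L * ε := by
        rw [Finset.sum_const, Finset.card_range, nsmul_eq_mul]
        field_simp

lemma tendsto_riemannSum_prod {F : ℝ → ℝ → ℝ} (hF : Continuous (Function.uncurry F))
    {L : ℝ} (hL : 0 < L) :
    Tendsto (fun p : ℕ × ℕ => L / p.1 * (L / p.2) *
        ∑ k ∈ Finset.range p.1, ∑ l ∈ Finset.range p.2, F (L / p.1 * k) (L / p.2 * l))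
      (atTop ×ˢ atTop) (nhds (∫ x in (0 : ℝ)..L, ∫ y in (0 : ℝ)..L, F x y)) := by
  rw [Metric.tendsto_nhds]
  intro ε hε
  have hUC := (isCompact_Icc (a := (0 : ℝ)) (b := L)).prod (isCompact_Icc (a := (0 : ℝ)) (b := L))
    |>.uniformContinuousOn_of_continuous hF.continuousOn
  rw [Metric.uniformContinuousOn_iff] at hUC
  set η := ε / (4 * L ^ 2) with hη_def
  have hη : 0 < η := by positivity
  obtain ⟨δ, hδ, hclose⟩ := hUC η hη
  have hev : ∀ᶠ n : ℕ in atTop, 0 < n ∧ L / n < δ :=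
    (eventually_gt_atTop 0).and
      ((tendsto_const_div_atTop_nhds_zero_nat L).eventually_lt_const hδ)
  filter_upwards [hev.prod_mk hev] with ⟨n, m⟩ ⟨⟨hn, hnδ⟩, hm, hmδ⟩
  dsimp only at hn hnδ hm hmδ ⊢
  have hn' : (0 : ℝ) < n := by exact_mod_cast hn
  have hy : ∀ x ∈ Set.Icc 0 L, ∀ y ∈ Set.Icc 0 L, ∀ y' ∈ Set.Icc 0 L, |y - y'| ≤ L / m →
      |F x y - F x y'| ≤ η := by
    intro x hx y hy y' hy' hd
    refine (hclose (x, y) ⟨hx, hy⟩ (x, y') ⟨hx, hy'⟩ ?_).le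
    rw [Prod.dist_eq, _root_.dist_self, Real.dist_eq]
    exact max_lt hδ (hd.trans_lt hmδ)
  have hx : ∀ x ∈ Set.Icc 0 L, ∀ x' ∈ Set.Icc 0 L, ∀ y ∈ Set.Icc 0 L, |x - x'| ≤ L / n →
      |F x y - F x' y| ≤ η := by
    intro x hx x' hx' y hy hd
    refine (hclose (x, y) ⟨hx, hy⟩ (x', y) ⟨hx', hy⟩ ?_).le
    rw [Prod.dist_eq, _root_.dist_self, Real.dist_eq]
    exact max_lt (hd.trans_lt hnδ) hδ
  have hFx (x : ℝ) : Continuous (F x) := hF.comp (by fun_prop : Continuous fun y => (x, y))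
  have hG : Continuous fun x => ∫ y in (0 : ℝ)..L, F x y :=
    intervalIntegral.continuous_parametric_intervalIntegral_of_continuous' hF 0 L
  have houter := abs_riemannSum_sub_integral_le hG hL.le hn (ε := L * η) (by
    intro x hxm x' hxm' hd
    rw [← intervalIntegral.integral_sub ((hFx x).intervalIntegrable _ _)
      ((hFx x').intervalIntegrable _ _)]
    have := intervalIntegral.norm_integral_le_of_norm_le_const (C := η)
      (f := fun y => F x y - F x' y) (a := 0) (b := L) (by
        intro y hym
        rw [Set.uIoc_of_le hL.le] at hym
        exact hx x hxm x' hxm' y ⟨hym.1.le, hym.2⟩ hd)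
    rwa [sub_zero, abs_of_pos hL, mul_comm] at this)
  have hinner : |L / n * ∑ k ∈ Finset.range n, (L / m * ∑ l ∈ Finset.range m,
        F (L / n * k) (L / m * l)) - L / n * ∑ k ∈ Finset.range n,
        ∫ y in (0 : ℝ)..L, F (L / n * k) y| ≤ L * (L * η) := by
    rw [← mul_sub, ← Finset.sum_sub_distrib, abs_mul, abs_of_pos (by positivity : 0 < L / n)]
    calc _ ≤ L / n * ∑ k ∈ Finset.range n, L * η := by
          gcongr
          refine (Finset.abs_sum_le_sum_abs _ _).trans (Finset.sum_le_sum fun k hk => ?_)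
          have hk' : (k : ℝ) ≤ n := by exact_mod_cast (Finset.mem_range.mp hk).le
          refine abs_riemannSum_sub_integral_le (hFx _) hL.le hm
            (hy _ ⟨by positivity, ?_⟩)
          calc L / n * k ≤ L / n * n := by gcongr
            _ = L := div_mul_cancel₀ L hn'.ne'
      _ = L * (L * η) := by
          rw [Finset.sum_const, Finset.card_range, nsmul_eq_mul]
          field_simp
  rw [Real.dist_eq]
  have hrw : L / n * (L / m) * ∑ k ∈ Finset.range n, ∑ l ∈ Finset.range m,
      F (L / n * k) (L / m * l) = L / n * ∑ k ∈ Finset.range n, (L / m * ∑ l ∈ Finset.range m,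
        F (L / n * k) (L / m * l)) := by
    rw [← Finset.mul_sum, mul_assoc]
  rw [hrw]
  refine (abs_sub_le _ _ _).trans_lt ((add_le_add hinner houter).trans_lt ?_)
  have : L * (L * η) = ε / 4 := by rw [hη_def]; field_simp
  linarith

/-- The eigenvalue `2 cos x ± √(3 + 2 cos x + 2 cos y + 2 cos (x + y))` of the lattice symbol. -/
noncomputable def sqTriSymbol (x y : ℝ) (s : Bool) : ℝ :=
  2 * Real.cos x + (if s then -1 else 1) *
    Real.sqrt (3 + 2 * Real.cos x + 2 * Real.cos y + 2 * Real.cos (x + y))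

lemma exists_phase (h : ℂ) :
    ∃ p : ℂ, p * h = ‖h‖ ∧ p * ‖h‖ = starRingEnd ℂ h ∧ starRingEnd ℂ p * p = 1 := by
  by_cases h0 : h = 0
  · exact ⟨1, by simp [h0]⟩
  · have hn : (‖h‖ : ℂ) ≠ 0 := by simpa using h0
    have hsq : starRingEnd ℂ h * h = ‖h‖ ^ 2 := by rw [mul_comm, Complex.mul_conj']
    refine ⟨starRingEnd ℂ h / ‖h‖, ?_, ?_, ?_⟩
    · rw [div_mul_eq_mul_div, hsq]
      field_simp
    · field_simp
    · simp only [map_div₀, Complex.conj_conj, Complex.conj_ofReal]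
      rw [div_mul_div_comm, mul_comm h, hsq]
      field_simp

lemma norm_one_add_exp_add_exp (x y : ℝ) :
    ‖1 + Complex.exp (-(y * Complex.I)) + Complex.exp (x * Complex.I)‖ =
      Real.sqrt (3 + 2 * Real.cos x + 2 * Real.cos y + 2 * Real.cos (x + y)) := by
  rw [← neg_mul, ← Complex.ofReal_neg, Complex.norm_eq_sqrt_sq_add_sq]
  simp only [Complex.add_re, Complex.add_im, Complex.one_re, Complex.one_im,
    Complex.exp_ofReal_mul_I_re, Complex.exp_ofReal_mul_I_im, Real.cos_neg, Real.sin_neg]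
  congr 1
  rw [Real.cos_add]
  linear_combination Real.sin_sq_add_cos_sq x + Real.sin_sq_add_cos_sq y

lemma ZMod.stdAddChar_eq_exp {n : ℕ} [NeZero n] (k : ZMod n) :
    ZMod.stdAddChar k = Complex.exp (((2 * π / n * k.val : ℝ) : ℂ) * Complex.I) := by
  rw [ZMod.stdAddChar_apply, ZMod.toCircle_apply]
  congr 1
  push_cast
  ring

lemma ZMod.sum_conj_stdAddChar_mul {n : ℕ} [NeZero n] (k k' : ZMod n) :
    ∑ i : ZMod n, starRingEnd ℂ (ZMod.stdAddChar (i * k)) * ZMod.stdAddChar (i * k') =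
      if k = k' then (n : ℂ) else 0 := by
  have h := AddChar.sum_mulShift (k' - k) (ZMod.isPrimitive_stdAddChar n)
  rw [ZMod.card] at h
  simp only [sub_eq_zero, eq_comm (a := k')] at h
  rw [Nat.cast_ite, Nat.cast_zero] at h
  rw [← h]
  refine Finset.sum_congr rfl fun i _ => ?_
  rw [← AddChar.map_neg_eq_conj, ← AddChar.map_add_eq_mul]
  congr 1
  ring

section Spectrum

variable {n m : ℕ}

lemma ZMod.one_ne_zero_of_three_le (hn : 3 ≤ n) : (1 : ZMod n) ≠ 0 := by
  have : Fact (1 < n) := ⟨by omega⟩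
  exact one_ne_zero

lemma ZMod.two_ne_zero_of_three_le (hn : 3 ≤ n) : (2 : ZMod n) ≠ 0 := by
  intro h
  have h2 : ((2 : ℕ) : ZMod n) = 0 := by exact_mod_cast h
  rw [ZMod.natCast_eq_zero_iff] at h2
  exact absurd (Nat.le_of_dvd two_pos h2) (by omega)

lemma sum_neighborFinset_sqTriTorus_false [NeZero n] [NeZero m] (hn : 3 ≤ n) (hm : 3 ≤ m)
    [DecidableRel (sqTriTorus n m).Adj] (f : ZMod n × ZMod m × Bool → ℂ)
    (i : ZMod n) (j : ZMod m) :
    ∑ v ∈ (sqTriTorus n m).neighborFinset (i, j, false), f v =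
      f (i, j, true) + f (i, j - 1, true) + f (i + 1, j, true) + f (i + 1, j, false) +
        f (i - 1, j, false) := by
  have h1 := ZMod.one_ne_zero_of_three_le hn
  have h2 := ZMod.two_ne_zero_of_three_le hn
  have h1' := ZMod.one_ne_zero_of_three_le hm
  have hset : (sqTriTorus n m).neighborFinset (i, j, false) =
      {(i, j, true), (i, j - 1, true), (i + 1, j, true), (i + 1, j, false),
        (i - 1, j, false)} := by
    ext ⟨a, b, c⟩
    rw [SimpleGraph.mem_neighborFinset, sqTriTorus, SimpleGraph.fromRel_adj]
    simp only [Finset.mem_insert, Finset.mem_singleton, Prod.mk.injEq]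
    cases c <;> grind
  have hne : i + 1 ≠ i - 1 := fun h => h2 (by linear_combination h)
  rw [hset, Finset.sum_insert, Finset.sum_insert, Finset.sum_insert, Finset.sum_insert,
    Finset.sum_singleton]
  · ring
  all_goals simp [h1, h1', hne, eq_sub_iff_add_eq]

lemma sum_neighborFinset_sqTriTorus_true [NeZero n] [NeZero m] (hn : 3 ≤ n) (hm : 3 ≤ m)
    [DecidableRel (sqTriTorus n m).Adj] (f : ZMod n × ZMod m × Bool → ℂ)
    (i : ZMod n) (j : ZMod m) :
    ∑ v ∈ (sqTriTorus n m).neighborFinset (i, j, true), f v =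
      f (i, j, false) + f (i, j + 1, false) + f (i - 1, j, false) + f (i + 1, j, true) +
        f (i - 1, j, true) := by
  have h1 := ZMod.one_ne_zero_of_three_le hn
  have h2 := ZMod.two_ne_zero_of_three_le hn
  have h1' := ZMod.one_ne_zero_of_three_le hm
  have hset : (sqTriTorus n m).neighborFinset (i, j, true) =
      {(i, j, false), (i, j + 1, false), (i - 1, j, false), (i + 1, j, true),
        (i - 1, j, true)} := by
    ext ⟨a, b, c⟩
    rw [SimpleGraph.mem_neighborFinset, sqTriTorus, SimpleGraph.fromRel_adj]
    simp only [Finset.mem_insert, Finset.mem_singleton, Prod.mk.injEq]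
    cases c <;> grind
  have hne : i + 1 ≠ i - 1 := fun h => h2 (by linear_combination h)
  rw [hset, Finset.sum_insert, Finset.sum_insert, Finset.sum_insert, Finset.sum_insert,
    Finset.sum_singleton]
  · ring
  all_goals simp [h1, h1', hne, eq_sub_iff_add_eq]

lemma graphEnergy_sqTriTorus [NeZero n] [NeZero m] (hn : 3 ≤ n) (hm : 3 ≤ m) :
    graphEnergy (sqTriTorus n m) = ∑ w : ZMod n × ZMod m × Bool,
      |sqTriSymbol (2 * π / n * w.1.val) (2 * π / m * w.2.1.val) w.2.2| := by
  let h (k : ZMod n) (l : ZMod m) : ℂ := 1 + ZMod.stdAddChar (-l) + ZMod.stdAddChar k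
  choose p hp1 hp2 hp3 using fun k l => exists_phase (h k l)
  let sgn (s : Bool) : ℂ := if s then -1 else 1
  let P : Matrix (ZMod n × ZMod m × Bool) (ZMod n × ZMod m × Bool) ℂ := fun u w =>
    ZMod.stdAddChar (u.1 * w.1) * ZMod.stdAddChar (u.2.1 * w.2.1) *
      if u.2.2 then sgn w.2.2 * p w.1 w.2.1 else 1
  have hsgn (s : Bool) : sgn s * sgn s = 1 := by cases s <;> simp [sgn]
  have hconj (k : ZMod n) (l : ZMod m) :
      starRingEnd ℂ (h k l) = 1 + ZMod.stdAddChar l + ZMod.stdAddChar (-k) := by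
    simp only [h, map_add, map_one, ← AddChar.map_neg_eq_conj, neg_neg]
  have hcos (k : ZMod n) : ZMod.stdAddChar k + ZMod.stdAddChar (-k) =
      ((2 * Real.cos (2 * π / n * k.val) : ℝ) : ℂ) := by
    rw [AddChar.map_neg_eq_conj, Complex.add_conj, ZMod.stdAddChar_eq_exp,
      Complex.exp_ofReal_mul_I_re]
  have hd (k : ZMod n) (l : ZMod m) (s : Bool) :
      ((sqTriSymbol (2 * π / n * k.val) (2 * π / m * l.val) s : ℝ) : ℂ) =
        ZMod.stdAddChar k + ZMod.stdAddChar (-k) + sgn s * ‖h k l‖ := by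
    have hnorm : ‖h k l‖ = _ :=
      (congrArg norm (by
        simp only [h, AddChar.map_neg_eq_inv, ZMod.stdAddChar_eq_exp, Complex.exp_neg])).trans
      (norm_one_add_exp_add_exp (2 * π / n * k.val) (2 * π / m * l.val))
    rw [hcos, hnorm, sqTriSymbol, Complex.ofReal_add, Complex.ofReal_mul _ (Real.sqrt _)]
    cases s <;> simp [sgn]
  refine graphEnergy_eq_of_eigenvectors _ P _ (c := 2 * (n : ℂ) * m) ?_ ?_ ?_
  · simp [NeZero.ne]
  · ext ⟨k, l, s⟩ ⟨k', l', s'⟩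
    have hfactor : (P.conjTranspose * P) (k, l, s) (k', l', s') =
        (∑ i, starRingEnd ℂ (ZMod.stdAddChar (i * k)) * ZMod.stdAddChar (i * k')) *
        (∑ j, starRingEnd ℂ (ZMod.stdAddChar (j * l)) * ZMod.stdAddChar (j * l')) *
        (1 + starRingEnd ℂ (sgn s * p k l) * (sgn s' * p k' l')) := by
      rw [Matrix.mul_apply, Fintype.sum_prod_type, Finset.sum_mul_sum, Finset.sum_mul]
      refine Finset.sum_congr rfl fun i _ => ?_
      rw [Fintype.sum_prod_type, Finset.sum_mul]
      refine Finset.sum_congr rfl fun j _ => ?_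
      simp only [Fintype.sum_bool, Matrix.conjTranspose_apply]
      simp [P]
      ring
    rw [hfactor, ZMod.sum_conj_stdAddChar_mul, ZMod.sum_conj_stdAddChar_mul,
      Matrix.smul_apply, Matrix.one_apply]
    by_cases hk : k = k'
    · by_cases hl : l = l'
      · subst hk hl
        have hpp : starRingEnd ℂ (sgn s * p k l) * (sgn s' * p k l) = sgn s * sgn s' := by
          have hs : starRingEnd ℂ (sgn s) = sgn s := by cases s <;> simp [sgn]
          rw [map_mul, hs]
          linear_combination sgn s * sgn s' * hp3 k l
        rw [hpp]
        cases s <;> cases s' <;> simp [sgn] <;> ring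
      · simp [hl]
    · simp [hk]
  · rintro _ ⟨i, j, c⟩ ⟨k, l, s⟩
    rw [hd]
    cases c
    · rw [sum_neighborFinset_sqTriTorus_false hn hm]
      have := hp1 k l
      simp only [P, h, sub_eq_add_neg, add_mul, neg_mul, one_mul, AddChar.map_add_eq_mul, if_true,
        Bool.false_eq_true, if_false] at this ⊢
      linear_combination ZMod.stdAddChar (i * k) * ZMod.stdAddChar (j * l) * sgn s * this
    · rw [sum_neighborFinset_sqTriTorus_true hn hm]
      have := hp2 k l
      rw [hconj] at this
      simp only [P, sub_eq_add_neg, add_mul, neg_mul, one_mul, AddChar.map_add_eq_mul, if_true,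
        Bool.false_eq_true, if_false]
      linear_combination ZMod.stdAddChar (i * k) * ZMod.stdAddChar (j * l) *
        (-this - p k l * ‖h k l‖ * hsgn s)

end Spectrum

lemma sqTriTorusEnergy_eq_sum {n m : ℕ} (hn : 3 ≤ n) (hm : 3 ≤ m) :
    sqTriTorusEnergy n m = ∑ k ∈ Finset.range n, ∑ l ∈ Finset.range m,
      (|sqTriSymbol (2 * π / n * k) (2 * π / m * l) false| +
        |sqTriSymbol (2 * π / n * k) (2 * π / m * l) true|) := by
  obtain ⟨n, rfl⟩ : ∃ k, n = k + 1 := ⟨n - 1, by omega⟩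
  obtain ⟨m, rfl⟩ : ∃ k, m = k + 1 := ⟨m - 1, by omega⟩
  rw [sqTriTorusEnergy, graphEnergy_sqTriTorus hn hm, Fintype.sum_prod_type,
    ← Fin.sum_univ_eq_sum_range]
  refine Finset.sum_congr rfl fun k _ => ?_
  rw [Fintype.sum_prod_type, ← Fin.sum_univ_eq_sum_range]
  refine Finset.sum_congr rfl fun l _ => ?_
  rw [Fintype.sum_bool, add_comm]
  rfl

/-- the energy per vertex of the toroidal `3³.4²` lattice converges,
as `n, m → ∞` jointly, to `(1/(8π²)) ∫₀^{2π} ∫₀^{2π} (|2cos x + sqrt(3 + 2cos x +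
2cos y + 2cos(x+y))| + |2cos x − sqrt(3 + 2cos x + 2cos y + 2cos(x+y))|) dx dy`. -/
theorem energy_per_vertex_sqTriTorus :
    Tendsto (fun p : ℕ × ℕ => sqTriTorusEnergy p.1 p.2 / (2 * (p.1 : ℝ) * (p.2 : ℝ)))
      (atTop ×ˢ atTop)
      (nhds ((1 / (8 * π ^ 2)) *
        ∫ x in (0:ℝ)..2 * π, ∫ y in (0:ℝ)..2 * π,
          (|2 * Real.cos x +
              Real.sqrt (3 + 2 * Real.cos x + 2 * Real.cos y + 2 * Real.cos (x + y))| +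
            |2 * Real.cos x -
              Real.sqrt (3 + 2 * Real.cos x + 2 * Real.cos y + 2 * Real.cos (x + y))|))) := by
  have hlim := (tendsto_riemannSum_prod (F := fun x y =>
    |2 * Real.cos x +
        Real.sqrt (3 + 2 * Real.cos x + 2 * Real.cos y + 2 * Real.cos (x + y))| +
      |2 * Real.cos x -
        Real.sqrt (3 + 2 * Real.cos x + 2 * Real.cos y + 2 * Real.cos (x + y))|)
    (by simp only [Function.uncurry_def]; fun_prop) Real.two_pi_pos).const_mul (1 / (8 * π ^ 2))
  refine hlim.congr' ?_
  filter_upwards [(eventually_ge_atTop 3).prod_mk (eventually_ge_atTop 3)] with ⟨n, m⟩ ⟨hn, hm⟩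
  dsimp only at hn hm ⊢
  have hn0 : (n : ℝ) ≠ 0 := by norm_cast; omega
  have hm0 : (m : ℝ) ≠ 0 := by norm_cast; omega
  simp only [sqTriTorusEnergy_eq_sum hn hm, sqTriSymbol, Bool.false_eq_true, if_true, if_false,
    one_mul, neg_mul, ← sub_eq_add_neg]
  have hcell : 1 / (8 * π ^ 2) * (2 * π / n * (2 * π / m)) = (2 * (n : ℝ) * m)⁻¹ := by
    field_simp
    norm_num
  rw [← mul_assoc, hcell, inv_mul_eq_div]
end

section
/- Let n, m ≥ 3 and let H^t(n,m) be the toroidal hexagonal lattice: the simple graph on vertex set (ℤ/nℤ) × (ℤ/mℤ) × {0,1} in which (i,j,0) is adjacent exactly to (i,j,1), (i,j−1,1), and (i−1,j,1). Then the multiset of eigenvalues (with multiplicity) of the adjacency matrix of H^t(n,m) equals the multiset { ε·sqrt(3 + 2cos(2πi/n) + 2cos(2πj/m) + 2cos(2πi/n + 2πj/m)) : 0 ≤ i ≤ n−1, 0 ≤ j ≤ m−1, ε ∈ {+1, −1} }. -/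
open Real Filter SimpleGraph

/-- The toroidal hexagonal lattice `H^t(n,m)`: the simple graph on
`(ℤ/nℤ) × (ℤ/mℤ) × {0,1}` in which `(i,j,0)` is adjacent exactly to `(i,j,1)`,
`(i,j−1,1)` and `(i−1,j,1)`. -/
def hexTorus (n m : ℕ) : SimpleGraph (ZMod n × ZMod m × Bool) :=
  SimpleGraph.fromRel fun u v =>
    u.2.2 = false ∧ v.2.2 = true ∧
      ((v.1 = u.1 ∧ v.2.1 = u.2.1) ∨ (v.1 = u.1 ∧ v.2.1 = u.2.1 - 1) ∨
        (v.1 = u.1 - 1 ∧ v.2.1 = u.2.1))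

/-- If a real symmetric matrix is diagonalized over `ℂ`, with real diagonal entries `d`, then its
eigenvalues with multiplicity are the entries of `d`. -/
lemma Matrix.IsHermitian.map_eigenvalues_eq_of_mul_eq_mul_diagonal {V : Type*} [Fintype V]
    [DecidableEq V] {A : Matrix V V ℝ} (hA : A.IsHermitian) (d : V → ℝ) (U W : Matrix V V ℂ)
    (hWU : W * U = 1)
    (hAU : A.map Complex.ofRealHom * U = U * Matrix.diagonal fun v => (d v : ℂ)) :
    Finset.univ.val.map hA.eigenvalues = Finset.univ.val.map d := by
  have hchar : (A.map Complex.ofRealHom).charpoly =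
      (Matrix.diagonal fun v => (d v : ℂ)).charpoly := by
    calc (A.map Complex.ofRealHom).charpoly
        = (A.map Complex.ofRealHom * U * W).charpoly := by
          rw [Matrix.mul_assoc, mul_eq_one_comm.mp hWU, Matrix.mul_one]
      _ = (W * (U * Matrix.diagonal fun v => (d v : ℂ))).charpoly := by
          rw [Matrix.charpoly_mul_comm, hAU]
      _ = _ := by rw [← Matrix.mul_assoc, hWU, Matrix.one_mul]
  have hreal : A.charpoly = (Matrix.diagonal d).charpoly := by
    apply Polynomial.map_injective Complex.ofRealHom Complex.ofReal_injective
    rw [← Matrix.charpoly_map, ← Matrix.charpoly_map, hchar, Matrix.diagonal_map (map_zero _)]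
    rfl
  have hroots := hA.roots_charpoly_eq_eigenvalues
  rw [hreal, Matrix.charpoly_diagonal, Polynomial.roots_prod _ _ (by
    simp [Finset.prod_ne_zero_iff, Polynomial.X_sub_C_ne_zero])] at hroots
  simpa using hroots.symm

namespace hexTorus

/-- The neighbours of a vertex in the part `0`. -/
lemma adj_false_iff {n m : ℕ} (i : ZMod n) (j : ZMod m) (v : ZMod n × ZMod m × Bool) :
    (hexTorus n m).Adj (i, j, false) v ↔
      v = (i, j, true) ∨ v = (i, j - 1, true) ∨ v = (i - 1, j, true) := by
  obtain ⟨a, b, c⟩ := v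
  cases c <;> simp [hexTorus, SimpleGraph.fromRel_adj]

/-- The neighbours of a vertex in the part `1`. -/
lemma adj_true_iff {n m : ℕ} (i : ZMod n) (j : ZMod m) (v : ZMod n × ZMod m × Bool) :
    (hexTorus n m).Adj (i, j, true) v ↔
      v = (i, j, false) ∨ v = (i, j + 1, false) ∨ v = (i + 1, j, false) := by
  obtain ⟨a, b, c⟩ := v
  cases c <;> simp [hexTorus, SimpleGraph.fromRel_adj, eq_sub_iff_add_eq, eq_comm (a := a),
    eq_comm (a := b)]

variable {n m : ℕ} [NeZero n] [NeZero m]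

lemma adjMatrix_mulVec_false [DecidableRel (hexTorus n m).Adj] (hn : 3 ≤ n) (hm : 3 ≤ m)
    (x : ZMod n × ZMod m × Bool → ℂ) (i : ZMod n) (j : ZMod m) :
    ((hexTorus n m).adjMatrix ℂ).mulVec x (i, j, false) =
      x (i, j, true) + x (i, j - 1, true) + x (i - 1, j, true) := by
  have : Fact (1 < n) := ⟨by omega⟩
  have : Fact (1 < m) := ⟨by omega⟩
  have hN : (hexTorus n m).neighborFinset (i, j, false) =
      {(i, j, true), (i, j - 1, true), (i - 1, j, true)} := by
    ext v
    simp [adj_false_iff]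
  rw [SimpleGraph.adjMatrix_mulVec_apply, hN, Finset.sum_insert, Finset.sum_insert,
    Finset.sum_singleton, add_assoc] <;> simp [eq_sub_iff_add_eq]

lemma adjMatrix_mulVec_true [DecidableRel (hexTorus n m).Adj] (hn : 3 ≤ n) (hm : 3 ≤ m)
    (x : ZMod n × ZMod m × Bool → ℂ) (i : ZMod n) (j : ZMod m) :
    ((hexTorus n m).adjMatrix ℂ).mulVec x (i, j, true) =
      x (i, j, false) + x (i, j + 1, false) + x (i + 1, j, false) := by
  have : Fact (1 < n) := ⟨by omega⟩
  have : Fact (1 < m) := ⟨by omega⟩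
  have hN : (hexTorus n m).neighborFinset (i, j, true) =
      {(i, j, false), (i, j + 1, false), (i + 1, j, false)} := by
    ext v
    simp [adj_true_iff]
  rw [SimpleGraph.adjMatrix_mulVec_apply, hN, Finset.sum_insert, Finset.sum_insert,
    Finset.sum_singleton, add_assoc] <;> simp

open ZMod (stdAddChar)

/-- The symbol of the adjacency operator from the part `1` to the part `0` at the character
`(i, j) ↦ e(j l / m - i k / n)`. -/
noncomputable def symbol (k : ZMod n) (l : ZMod m) : ℂ :=
  1 + stdAddChar (-l) + stdAddChar k

/-- The phase of the symbol. -/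
noncomputable def phase (k : ZMod n) (l : ZMod m) : ℂ :=
  Complex.exp (Complex.arg (symbol k l) * Complex.I)

/-- The sign attached to a Boolean. -/
def sign (b : Bool) : ℝ := if b then 1 else -1

/-- The matrix whose columns are the eigenvectors of the adjacency matrix. -/
noncomputable def eigenmatrix (n m : ℕ) [NeZero n] [NeZero m] :
    Matrix (ZMod n × ZMod m × Bool) (ZMod n × ZMod m × Bool) ℂ :=
  Matrix.of fun v p =>
    (if v.2.2 then (sign p.2.2 : ℂ) else phase p.1 p.2.1) *
      (stdAddChar (-(v.1 * p.1)) * stdAddChar (v.2.1 * p.2.1))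

/-- The inverse of `eigenmatrix n m`. -/
noncomputable def eigenmatrixInv (n m : ℕ) [NeZero n] [NeZero m] :
    Matrix (ZMod n × ZMod m × Bool) (ZMod n × ZMod m × Bool) ℂ :=
  Matrix.of fun p v =>
    (2 * n * m : ℂ)⁻¹ * (if v.2.2 then (sign p.2.2 : ℂ) else (phase p.1 p.2.1)⁻¹) *
      (stdAddChar (v.1 * p.1) * stdAddChar (-(v.2.1 * p.2.1)))

lemma norm_mul_phase (k : ZMod n) (l : ZMod m) : ‖symbol k l‖ * phase k l = symbol k l :=
  Complex.norm_mul_exp_arg_mul_I _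

lemma phase_ne_zero (k : ZMod n) (l : ZMod m) : phase k l ≠ 0 := Complex.exp_ne_zero _

lemma conj_stdAddChar {N : ℕ} [NeZero N] (k : ZMod N) :
    (starRingEnd ℂ) (stdAddChar k) = stdAddChar (-k) := by
  rw [AddChar.map_neg_eq_conj]

lemma conj_symbol (k : ZMod n) (l : ZMod m) :
    (starRingEnd ℂ) (symbol k l) = 1 + stdAddChar l + stdAddChar (-k) := by
  simp [symbol, conj_stdAddChar]

lemma conj_symbol_mul_phase (k : ZMod n) (l : ZMod m) :
    (starRingEnd ℂ) (symbol k l) * phase k l = ‖symbol k l‖ := by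
  have hconj : (starRingEnd ℂ) (phase k l) * phase k l = 1 := by
    rw [Complex.conj_mul', phase, Complex.norm_exp_ofReal_mul_I]
    simp
  nth_rewrite 1 [← norm_mul_phase k l]
  rw [map_mul, Complex.conj_ofReal, mul_assoc, hconj, mul_one]

lemma eigenmatrixInv_mul_eigenmatrix : eigenmatrixInv n m * eigenmatrix n m = 1 := by
  ext ⟨k, l, b⟩ ⟨k', l', b'⟩
  have hn : (n : ℂ) ≠ 0 := NeZero.ne _
  have hm : (m : ℂ) ≠ 0 := NeZero.ne _
  have hk : ∑ i : ZMod n, (stdAddChar (i * k) * stdAddChar (-(i * k')) : ℂ) =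
      if k = k' then (n : ℂ) else 0 := by
    have h := AddChar.sum_mulShift (k - k') (ZMod.isPrimitive_stdAddChar n)
    simp only [sub_eq_zero, ZMod.card] at h
    rw [Nat.cast_ite, Nat.cast_zero] at h
    rw [← h]
    refine Finset.sum_congr rfl fun i _ => ?_
    rw [← AddChar.map_add_eq_mul]
    ring_nf
  have hl : ∑ j : ZMod m, (stdAddChar (-(j * l)) * stdAddChar (j * l') : ℂ) =
      if l = l' then (m : ℂ) else 0 := by
    have h := AddChar.sum_mulShift (l' - l) (ZMod.isPrimitive_stdAddChar m)
    simp only [sub_eq_zero, ZMod.card, eq_comm (a := l')] at h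
    rw [Nat.cast_ite, Nat.cast_zero] at h
    rw [← h]
    refine Finset.sum_congr rfl fun i _ => ?_
    rw [← AddChar.map_add_eq_mul]
    ring_nf
  have hsum : (eigenmatrixInv n m * eigenmatrix n m) (k, l, b) (k', l', b') =
      (2 * n * m : ℂ)⁻¹ * (sign b * sign b' + (phase k l)⁻¹ * phase k' l') *
        ((∑ i : ZMod n, (stdAddChar (i * k) * stdAddChar (-(i * k')) : ℂ)) *
          ∑ j : ZMod m, (stdAddChar (-(j * l)) * stdAddChar (j * l') : ℂ)) := by
    rw [Finset.sum_mul_sum, Finset.mul_sum, Matrix.mul_apply, Fintype.sum_prod_type]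
    refine Finset.sum_congr rfl fun i _ => ?_
    rw [Finset.mul_sum, Fintype.sum_prod_type]
    refine Finset.sum_congr rfl fun j _ => ?_
    simp only [eigenmatrixInv, eigenmatrix, Matrix.of_apply, Fintype.sum_bool, if_true,
      Bool.false_eq_true, if_false]
    ring
  rw [hsum, hk, hl, Matrix.one_apply]
  by_cases h₁ : k = k'
  · by_cases h₂ : l = l'
    · subst h₁ h₂
      have := inv_mul_cancel₀ (phase_ne_zero k l)
      cases b <;> cases b' <;> simp [sign, this] <;> field_simp <;> norm_num
    · simp [h₂]
  · simp [h₁]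

lemma adjMatrix_mul_eigenmatrix [DecidableRel (hexTorus n m).Adj] (hn : 3 ≤ n) (hm : 3 ≤ m) :
    (hexTorus n m).adjMatrix ℂ * eigenmatrix n m = eigenmatrix n m *
      Matrix.diagonal fun p => ((sign p.2.2 * ‖symbol p.1 p.2.1‖ : ℝ) : ℂ) := by
  ext ⟨i, j, c⟩ ⟨k, l, b⟩
  have hb : (sign b : ℂ) * sign b = 1 := by cases b <;> simp [sign]
  rw [Matrix.mul_diagonal, Matrix.mul_apply_eq_vecMul]
  change ((hexTorus n m).adjMatrix ℂ).mulVec (fun v => eigenmatrix n m v (k, l, b)) _ = _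
  have hi (a : ZMod n) : -((i + a) * k) = -(i * k) + -(a * k) := by ring
  have hj (a : ZMod m) : (j + a) * l = j * l + a * l := by ring
  cases c
  · rw [adjMatrix_mulVec_false hn hm, sub_eq_add_neg, sub_eq_add_neg]
    simp only [eigenmatrix, Matrix.of_apply, if_true, Bool.false_eq_true, if_false, hi, hj,
      AddChar.map_add_eq_mul, neg_mul, one_mul, neg_neg, Complex.ofReal_mul]
    have h := norm_mul_phase k l
    rw [symbol] at h ⊢
    linear_combination (-sign b * (stdAddChar (-(i * k)) * stdAddChar (j * l)) : ℂ) * h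
  · rw [adjMatrix_mulVec_true hn hm]
    simp only [eigenmatrix, Matrix.of_apply, if_true, Bool.false_eq_true, if_false, hi, hj,
      AddChar.map_add_eq_mul, one_mul, Complex.ofReal_mul]
    have h := conj_symbol_mul_phase k l
    rw [conj_symbol] at h
    linear_combination (stdAddChar (-(i * k)) * stdAddChar (j * l) : ℂ) * h -
      (stdAddChar (-(i * k)) * stdAddChar (j * l) * ‖symbol k l‖ : ℂ) * hb

lemma stdAddChar_eq_cos_add_sin {N : ℕ} [NeZero N] (k : ZMod N) :
    (stdAddChar k : ℂ) = (Real.cos (2 * π * k.val / N) : ℂ) +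
      (Real.sin (2 * π * k.val / N) : ℂ) * Complex.I := by
  rw [ZMod.stdAddChar_apply, ZMod.toCircle_apply, Complex.ofReal_cos, Complex.ofReal_sin,
    ← Complex.exp_mul_I]
  push_cast
  ring_nf

lemma norm_symbol (k : ZMod n) (l : ZMod m) :
    ‖symbol k l‖ = Real.sqrt (3 + 2 * Real.cos (2 * π * k.val / n) +
      2 * Real.cos (2 * π * l.val / m) +
      2 * Real.cos (2 * π * k.val / n + 2 * π * l.val / m)) := by
  rw [Complex.norm_def, Complex.normSq_apply, symbol, ← conj_stdAddChar,
    stdAddChar_eq_cos_add_sin k, stdAddChar_eq_cos_add_sin l, Real.cos_add]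
  congr 1
  simp only [Complex.add_re, Complex.add_im, Complex.one_re, Complex.one_im, Complex.mul_re,
    Complex.mul_im, Complex.ofReal_re, Complex.ofReal_im, Complex.I_re, Complex.I_im,
    Complex.conj_re, Complex.conj_im]
  linear_combination Real.sin_sq_add_cos_sq (2 * π * k.val / n) +
    Real.sin_sq_add_cos_sq (2 * π * l.val / m)

lemma val_finEquiv {N : ℕ} [NeZero N] (k : Fin N) : (ZMod.finEquiv N k).val = k := by
  cases N with
  | zero => exact k.elim0
  | succ N => rfl

end hexTorus

/-- the multiset of eigenvalues of the toroidal hexagonal lattice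
`H^t(n,m)` (`n, m ≥ 3`) is
`{± sqrt(3 + 2cos(2πi/n) + 2cos(2πj/m) + 2cos(2πi/n + 2πj/m))}`,
over `0 ≤ i < n`, `0 ≤ j < m` and both signs. -/
theorem eigenvalues_hexTorus (n m : ℕ) [NeZero n] [NeZero m] (hn : 3 ≤ n) (hm : 3 ≤ m) :
    (Finset.univ.val.map fun v => graphEigenvalues (hexTorus n m) v) =
      (Finset.univ.val.map fun p : Fin n × Fin m × Bool =>
        (if p.2.2 then (1 : ℝ) else -1) *
          Real.sqrt (3 + 2 * Real.cos (2 * π * (p.1 : ℝ) / (n : ℝ)) +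
            2 * Real.cos (2 * π * (p.2.1 : ℝ) / (m : ℝ)) +
            2 * Real.cos (2 * π * (p.1 : ℝ) / (n : ℝ) + 2 * π * (p.2.1 : ℝ) / (m : ℝ)))) := by
  classical
  let e : Fin n × Fin m × Bool ≃ ZMod n × ZMod m × Bool :=
    (ZMod.finEquiv n).toEquiv.prodCongr ((ZMod.finEquiv m).toEquiv.prodCongr (Equiv.refl Bool))
  let d : ZMod n × ZMod m × Bool → ℝ := fun p => hexTorus.sign p.2.2 * ‖hexTorus.symbol p.1 p.2.1‖
  have heig : Finset.univ.val.map (graphEigenvalues (hexTorus n m)) = Finset.univ.val.map d := by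
    let _ := Classical.decRel (hexTorus n m).Adj
    refine (adjMatrix_isHermitian (hexTorus n m)).map_eigenvalues_eq_of_mul_eq_mul_diagonal d _ _
      hexTorus.eigenmatrixInv_mul_eigenmatrix ?_
    rw [← hexTorus.adjMatrix_mul_eigenmatrix hn hm]
    congr 1
    ext u v
    simp [SimpleGraph.adjMatrix_apply, apply_ite]
  calc _ = Finset.univ.val.map d := heig
    _ = Finset.univ.val.map (d ∘ e) := by
      rw [← Multiset.map_map, Multiset.map_univ_val_equiv]
    _ = _ := by
      refine Multiset.map_congr rfl fun p _ => ?_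
      simp only [d, Function.comp_apply, hexTorus.norm_symbol, e, Equiv.prodCongr_apply, Prod.map,
        RingEquiv.toEquiv_eq_coe, EquivLike.coe_coe, hexTorus.val_finEquiv, hexTorus.sign,
        Equiv.refl_apply]
      rfl
end

section
/- For the free-boundary hexagonal lattice H^f(n,m), the energy per vertex converges as n, m → ∞ (jointly, i.e., along the product filter): lim_{n,m→∞} E(H^f(n,m))/(2nm) = (1/(4π²)) ∫₀^{2π} ∫₀^{2π} sqrt(3 + 2cos x + 2cos y + 2cos(x+y)) dx dy. In particular the hexagonal lattices with free and toroidal boundary conditions have the same asymptotic energy per vertex. -/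
open Real Filter SimpleGraph

/-- The free-boundary hexagonal (brick-wall) lattice `H^f(n,m)`: the simple graph
on `{0,…,n−1} × {0,…,m−1} × {0,1}` in which `(i,j,0)` is adjacent to `(i,j,1)`,
to `(i,j−1,1)` when `j ≥ 1`, and to `(i−1,j,1)` when `i ≥ 1` (no wrap-around). -/
def hexFree (n m : ℕ) : SimpleGraph (Fin n × Fin m × Bool) :=
  SimpleGraph.fromRel fun u v =>
    u.2.2 = false ∧ v.2.2 = true ∧
      ((v.1 = u.1 ∧ v.2.1 = u.2.1) ∨
        (v.1 = u.1 ∧ (v.2.1 : ℕ) + 1 = (u.2.1 : ℕ)) ∨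
        ((v.1 : ℕ) + 1 = (u.1 : ℕ) ∧ v.2.1 = u.2.1))

section torusMean

open intervalIntegral

/-- The squared modulus of the symbol of the hexagonal lattice. -/
noncomputable def hexSymbol (x y : ℝ) : ℝ :=
  3 + 2 * Real.cos x + 2 * Real.cos y + 2 * Real.cos (x + y)

lemma hexSymbol_mem_Icc (x y : ℝ) : hexSymbol x y ∈ Set.Icc (0 : ℝ) 9 := by
  unfold hexSymbol
  constructor
  · have h : 3 + 2 * Real.cos x + 2 * Real.cos y + 2 * Real.cos (x + y) =
        (1 + Real.cos x + Real.cos y) ^ 2 + (Real.sin x - Real.sin y) ^ 2 := by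
      rw [Real.cos_add]
      linear_combination - Real.sin_sq_add_cos_sq x - Real.sin_sq_add_cos_sq y
    rw [h]
    positivity
  · linarith [Real.cos_le_one x, Real.cos_le_one y, Real.cos_le_one (x + y)]

@[fun_prop]
lemma continuous_hexSymbol : Continuous fun q : ℝ × ℝ => hexSymbol q.1 q.2 := by
  unfold hexSymbol
  fun_prop

/-- The mean over the torus of a function of two angles. -/
noncomputable def torusMean (φ : ℝ → ℝ → ℝ) : ℝ :=
  (1 / (4 * π ^ 2)) * ∫ x in (0 : ℝ)..2 * π, ∫ y in (0 : ℝ)..2 * π, φ x y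

lemma continuous_inner_integral {φ : ℝ → ℝ → ℝ} (h : Continuous (Function.uncurry φ)) :
    Continuous fun x => ∫ y in (0 : ℝ)..2 * π, φ x y :=
  continuous_parametric_intervalIntegral_of_continuous' h _ _

lemma torusMean_add {φ ψ : ℝ → ℝ → ℝ} (hφ : Continuous (Function.uncurry φ))
    (hψ : Continuous (Function.uncurry ψ)) :
    torusMean (fun x y => φ x y + ψ x y) = torusMean φ + torusMean ψ := by
  unfold torusMean
  rw [← mul_add, ← integral_add ((continuous_inner_integral hφ).intervalIntegrable _ _)
    ((continuous_inner_integral hψ).intervalIntegrable _ _)]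
  congr 1
  refine integral_congr fun x _ => ?_
  exact integral_add ((hφ.uncurry_left x).intervalIntegrable _ _)
    ((hψ.uncurry_left x).intervalIntegrable _ _)

lemma torusMean_const_mul (c : ℝ) (φ : ℝ → ℝ → ℝ) :
    torusMean (fun x y => c * φ x y) = c * torusMean φ := by
  simp only [torusMean, integral_const_mul]
  ring

lemma torusMean_zero : torusMean (fun _ _ => 0) = 0 := by simp [torusMean]

lemma torusMean_sum {ι : Type*} (s : Finset ι) {φ : ι → ℝ → ℝ → ℝ}
    (h : ∀ a ∈ s, Continuous (Function.uncurry (φ a))) :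
    torusMean (fun x y => ∑ a ∈ s, φ a x y) = ∑ a ∈ s, torusMean (φ a) := by
  classical
  induction s using Finset.induction_on with
  | empty => simp [torusMean_zero]
  | insert a s ha ih =>
    have hs : Continuous (Function.uncurry fun x y => ∑ a ∈ s, φ a x y) :=
      continuous_finsetSum s fun b hb => h b (Finset.mem_insert_of_mem hb)
    simp only [Finset.sum_insert ha]
    rw [torusMean_add (h a (Finset.mem_insert_self _ _)) hs,
      ih fun b hb => h b (Finset.mem_insert_of_mem hb)]

lemma abs_torusMean_le {φ : ℝ → ℝ → ℝ} {C : ℝ} (h : ∀ x y, |φ x y| ≤ C) :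
    |torusMean φ| ≤ C := by
  have pi_pos₂ : (0 : ℝ) < 2 * π := Real.two_pi_pos
  have inner (x : ℝ) : ‖∫ y in (0 : ℝ)..2 * π, φ x y‖ ≤ C * (2 * π) := by
    have := norm_integral_le_of_norm_le_const (a := (0 : ℝ)) (b := 2 * π) (C := C)
      (f := φ x) fun y _ => h x y
    rwa [sub_zero, abs_of_pos pi_pos₂] at this
  have := norm_integral_le_of_norm_le_const (a := (0 : ℝ)) (b := 2 * π) (C := C * (2 * π))
    (f := fun x => ∫ y in (0 : ℝ)..2 * π, φ x y) fun x _ => inner x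
  rw [sub_zero, abs_of_pos pi_pos₂, Real.norm_eq_abs] at this
  unfold torusMean
  rw [abs_mul, abs_of_pos (by positivity : 0 < 1 / (4 * π ^ 2))]
  calc _ ≤ 1 / (4 * π ^ 2) * (C * (2 * π) * (2 * π)) := by gcongr
    _ = C := by field_simp; ring

lemma integral_cos_sub_int_mul (t : ℝ) (b : ℤ) :
    ∫ y in (0 : ℝ)..2 * π, Real.cos (t - b * y) = if b = 0 then 2 * π * Real.cos t else 0 := by
  split_ifs with hb
  · simp [hb]
  · have hb' : (b : ℝ) ≠ 0 := by exact_mod_cast hb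
    rw [integral_comp_sub_mul (fun y => Real.cos y) hb', integral_cos]
    have : Real.sin (t - b * (2 * π)) = Real.sin t := Real.sin_sub_int_mul_two_pi t b
    simp [this]

lemma torusMean_cos (a b : ℤ) :
    torusMean (fun x y => Real.cos (a * x - b * y)) = if a = 0 ∧ b = 0 then 1 else 0 := by
  unfold torusMean
  simp only [integral_cos_sub_int_mul]
  by_cases hb : b = 0
  · have := integral_cos_sub_int_mul 0 a
    simp only [zero_sub, Real.cos_neg, Real.cos_zero, mul_one] at this
    simp only [hb, if_true, and_true, integral_const_mul, this]
    split_ifs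
    · field_simp
      ring
    · simp
  · simp [hb]

end torusMean

/-- The adjacency operator of the hexagonal lattice on `ℤ × ℤ × {0,1}`. -/
def latticeAdj (H : ℤ → ℤ → Bool → ℝ) : ℤ → ℤ → Bool → ℝ
  | i, j, false => H i j true + H i (j - 1) true + H (i - 1) j true
  | i, j, true => H i j false + H i (j + 1) false + H (i + 1) j false

/-- A standing wave on one sublattice, centred at `(a, b)`. -/
noncomputable def standingWave (x y : ℝ) (a b : ℤ) (s : Bool) (i j : ℤ) (t : Bool) : ℝ :=
  if t = s then Real.cos ((i - a : ℤ) * x - (j - b : ℤ) * y) else 0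

lemma latticeAdj_latticeAdj_standingWave (x y c : ℝ) (a b : ℤ) (s : Bool) :
    latticeAdj (latticeAdj fun i j t => c * standingWave x y a b s i j t) =
      fun i j t => (hexSymbol x y * c) * standingWave x y a b s i j t := by
  have key (θ : ℝ) : Real.cos (θ + x) + Real.cos (θ - x) + Real.cos (θ + y) + Real.cos (θ - y) +
      Real.cos (θ + x + y) + Real.cos (θ - x - y) = (hexSymbol x y - 3) * Real.cos θ := by
    have e₁ : θ + x + y = θ + (x + y) := by ring
    have e₂ : θ - x - y = θ - (x + y) := by ring
    rw [e₁, e₂]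
    simp only [hexSymbol, Real.cos_add, Real.cos_sub, Real.sin_add]
    ring
  funext i j t
  have hk := key ((i - a : ℤ) * x - (j - b : ℤ) * y)
  cases t <;> cases s <;> simp only [latticeAdj, standingWave, if_true, if_false,
    mul_zero, add_zero, Bool.false_eq_true, Bool.true_eq_false] <;> push_cast at hk ⊢ <;>
  · ring_nf at hk ⊢
    linear_combination c * hk

lemma latticeAdj_iterate_standingWave (x y : ℝ) (a b : ℤ) (s : Bool) (k : ℕ) :
    latticeAdj^[2 * k] (standingWave x y a b s) =
      fun i j t => hexSymbol x y ^ k * standingWave x y a b s i j t := by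
  induction k with
  | zero => simp
  | succ k ih =>
    rw [mul_add, mul_one, Function.iterate_succ_apply', Function.iterate_succ_apply', ih,
      latticeAdj_latticeAdj_standingWave, pow_succ']

/-- Vertices at distance at least `d` from the boundary of the `n × m` box. -/
def IsDeep {n m : ℕ} (d : ℕ) (v : Fin n × Fin m × Bool) : Prop :=
  d ≤ (v.1 : ℕ) ∧ (v.1 : ℕ) + d < n ∧ d ≤ (v.2.1 : ℕ) ∧ (v.2.1 : ℕ) + d < m

lemma hexFree_adj_false {n m : ℕ} {i i' : Fin n} {j j' : Fin m} {t : Bool} :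
    (hexFree n m).Adj (i, j, false) (i', j', t) ↔ t = true ∧
      (((i' : ℤ) = i ∧ (j' : ℤ) = j) ∨ ((i' : ℤ) = i ∧ (j' : ℤ) = j - 1) ∨
        ((i' : ℤ) = i - 1 ∧ (j' : ℤ) = j)) := by
  cases t
  · simp [hexFree]
  · simp [hexFree, Fin.ext_iff]
    lia

lemma hexFree_adj_true {n m : ℕ} {i i' : Fin n} {j j' : Fin m} {t : Bool} :
    (hexFree n m).Adj (i, j, true) (i', j', t) ↔ t = false ∧
      (((i' : ℤ) = i ∧ (j' : ℤ) = j) ∨ ((i' : ℤ) = i ∧ (j' : ℤ) = j + 1) ∨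
        ((i' : ℤ) = i + 1 ∧ (j' : ℤ) = j)) := by
  cases t
  · simp [hexFree, Fin.ext_iff]
    lia
  · simp [hexFree]

section hexFree

variable {n m : ℕ} [DecidableRel (hexFree n m).Adj]

lemma hexFree_degree_le (v : Fin n × Fin m × Bool) : (hexFree n m).degree v ≤ 3 := by
  rw [← card_neighborFinset_eq_degree]
  obtain ⟨i, j, s⟩ := v
  let e : Fin n × Fin m × Bool → ℤ × ℤ := fun u => ((u.1 : ℤ), (u.2.1 : ℤ))
  have inj : Set.InjOn e ((hexFree n m).neighborFinset (i, j, s)) := by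
    rintro ⟨a, b, t⟩ h ⟨a', b', t'⟩ h' he
    simp only [e, Prod.mk.injEq, Nat.cast_inj, Fin.val_inj] at he
    simp only [Finset.mem_coe, mem_neighborFinset] at h h'
    cases s
    · rw [hexFree_adj_false] at h h'
      simp [he, h.1, h'.1]
    · rw [hexFree_adj_true] at h h'
      simp [he, h.1, h'.1]
  cases s
  · refine (Finset.card_le_card_of_injOn e (t := {((i : ℤ), (j : ℤ)), ((i : ℤ), (j : ℤ) - 1),
      ((i : ℤ) - 1, (j : ℤ))}) ?_ inj).trans Finset.card_le_three
    rintro ⟨a, b, t⟩ h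
    simp only [Finset.mem_coe, mem_neighborFinset, hexFree_adj_false] at h
    simpa [e] using h.2
  · refine (Finset.card_le_card_of_injOn e (t := {((i : ℤ), (j : ℤ)), ((i : ℤ), (j : ℤ) + 1),
      ((i : ℤ) + 1, (j : ℤ))}) ?_ inj).trans Finset.card_le_three
    rintro ⟨a, b, t⟩ h
    simp only [Finset.mem_coe, mem_neighborFinset, hexFree_adj_true] at h
    simpa [e] using h.2

lemma adjMatrix_mulVec_eq_latticeAdj {d : ℕ} {h : Fin n × Fin m × Bool → ℝ}
    {H : ℤ → ℤ → Bool → ℝ} (hH : ∀ v, IsDeep d v → h v = H (v.1 : ℕ) (v.2.1 : ℕ) v.2.2)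
    (v : Fin n × Fin m × Bool) (hv : IsDeep (d + 1) v) :
    ((hexFree n m).adjMatrix ℝ).mulVec h v = latticeAdj H (v.1 : ℕ) (v.2.1 : ℕ) v.2.2 := by
  obtain ⟨⟨i, hi⟩, ⟨j, hj⟩, s⟩ := v
  simp only [IsDeep] at hv
  rw [adjMatrix_mulVec_apply]
  cases s
  · have : (hexFree n m).neighborFinset (⟨i, hi⟩, ⟨j, hj⟩, false) =
        {(⟨i, hi⟩, ⟨j, hj⟩, true), (⟨i, hi⟩, ⟨j - 1, by lia⟩, true),
          (⟨i - 1, by lia⟩, ⟨j, hj⟩, true)} := by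
      ext ⟨a, b, t⟩
      simp only [mem_neighborFinset, hexFree_adj_false, Finset.mem_insert, Finset.mem_singleton,
        Prod.mk.injEq, Fin.ext_iff]
      lia
    rw [this, Finset.sum_insert, Finset.sum_insert, Finset.sum_singleton, hH, hH, hH]
    · simp only [latticeAdj]
      rw [Nat.cast_sub (by lia), Nat.cast_sub (by lia), Nat.cast_one, add_assoc]
    all_goals (simp [IsDeep]; lia)
  · have : (hexFree n m).neighborFinset (⟨i, hi⟩, ⟨j, hj⟩, true) =
        {(⟨i, hi⟩, ⟨j, hj⟩, false), (⟨i, hi⟩, ⟨j + 1, by lia⟩, false),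
          (⟨i + 1, by lia⟩, ⟨j, hj⟩, false)} := by
      ext ⟨a, b, t⟩
      simp only [mem_neighborFinset, hexFree_adj_true, Finset.mem_insert, Finset.mem_singleton,
        Prod.mk.injEq, Fin.ext_iff]
      lia
    rw [this, Finset.sum_insert, Finset.sum_insert, Finset.sum_singleton, hH, hH, hH]
    · simp only [latticeAdj]
      push_cast
      rw [add_assoc]
    all_goals simp [IsDeep] <;> lia

lemma adjMatrix_pow_mulVec_eq_latticeAdj (H : ℤ → ℤ → Bool → ℝ) (d : ℕ)
    (v : Fin n × Fin m × Bool) (hv : IsDeep d v) :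
    ((hexFree n m).adjMatrix ℝ ^ d).mulVec (fun u => H (u.1 : ℕ) (u.2.1 : ℕ) u.2.2) v =
      latticeAdj^[d] H (v.1 : ℕ) (v.2.1 : ℕ) v.2.2 := by
  induction d generalizing v with
  | zero => simp
  | succ d ih =>
    rw [pow_succ', ← Matrix.mulVec_mulVec, Function.iterate_succ_apply']
    exact adjMatrix_mulVec_eq_latticeAdj ih v hv

/-- The moments of the symbol of the hexagonal lattice. -/
noncomputable def hexMoment (k : ℕ) : ℝ := torusMean fun x y => hexSymbol x y ^ k

lemma adjMatrix_pow_apply_self_of_isDeep (k : ℕ) (v : Fin n × Fin m × Bool)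
    (hv : IsDeep (2 * k) v) : ((hexFree n m).adjMatrix ℝ ^ (2 * k)) v v = hexMoment k := by
  set P := (hexFree n m).adjMatrix ℝ ^ (2 * k) with hP
  have pointwise (x y : ℝ) : hexSymbol x y ^ k = ∑ u, P v u *
      standingWave x y (v.1 : ℕ) (v.2.1 : ℕ) v.2.2 (u.1 : ℕ) (u.2.1 : ℕ) u.2.2 := by
    have := adjMatrix_pow_mulVec_eq_latticeAdj
      (standingWave x y (v.1 : ℕ) (v.2.1 : ℕ) v.2.2) (2 * k) v hv
    rw [latticeAdj_iterate_standingWave] at this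
    simp only [Matrix.mulVec, dotProduct] at this
    rw [hP, this]
    simp [standingWave]
  have mean (u : Fin n × Fin m × Bool) : torusMean (fun x y =>
      standingWave x y (v.1 : ℕ) (v.2.1 : ℕ) v.2.2 (u.1 : ℕ) (u.2.1 : ℕ) u.2.2) =
      if u = v then 1 else 0 := by
    unfold standingWave
    by_cases h : u.2.2 = v.2.2
    · simp only [h, if_true, torusMean_cos]
      congr 1
      simp [Prod.ext_iff, h, sub_eq_zero, Fin.ext_iff]
    · rw [if_neg fun e => h (by rw [e])]
      simp [h, torusMean_zero]
  simp only [hexMoment, pointwise]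
  rw [torusMean_sum]
  · simp [torusMean_const_mul, mean]
  · intro u _
    unfold standingWave Function.uncurry
    split_ifs <;> fun_prop

lemma abs_adjMatrix_pow_apply_le (k : ℕ) (v w : Fin n × Fin m × Bool) :
    |((hexFree n m).adjMatrix ℝ ^ k) v w| ≤ 3 ^ k := by
  induction k generalizing v with
  | zero =>
    rw [pow_zero, Matrix.one_apply]
    split_ifs <;> simp
  | succ k ih =>
    rw [pow_succ', adjMatrix_mul_apply, pow_succ']
    calc _ ≤ ∑ u ∈ (hexFree n m).neighborFinset v, |((hexFree n m).adjMatrix ℝ ^ k) u w| :=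
          Finset.abs_sum_le_sum_abs _ _
      _ ≤ ∑ u ∈ (hexFree n m).neighborFinset v, (3 : ℝ) ^ k := Finset.sum_le_sum fun u _ => ih u
      _ ≤ 3 * 3 ^ k := by
        rw [Finset.sum_const, nsmul_eq_mul, card_neighborFinset_eq_degree]
        gcongr
        exact_mod_cast hexFree_degree_le v

end hexFree

lemma Matrix.IsHermitian.sum_eigenvalues_pow {V : Type*} [Fintype V] [DecidableEq V]
    {A : Matrix V V ℝ} (hA : A.IsHermitian) (k : ℕ) :
    ∑ v, hA.eigenvalues v ^ k = (A ^ k).trace := by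
  conv_rhs => rw [hA.spectral_theorem, ← map_pow, Matrix.diagonal_pow,
    Unitary.conjStarAlgAut_apply, Matrix.trace_mul_comm, ← mul_assoc]
  simp [Matrix.trace]

lemma abs_eigenvalues_adjMatrix_le {V : Type*} [Fintype V] [DecidableEq V] {G : SimpleGraph V}
    [DecidableRel G.Adj] {d : ℕ} (hG : ∀ v, G.degree v ≤ d) (v : V) :
    |(adjMatrix_isHermitian G).eigenvalues v| ≤ d := by
  set hA := adjMatrix_isHermitian G
  have hv : Module.End.HasEigenvalue (Matrix.toLin' (G.adjMatrix ℝ)) (hA.eigenvalues v) := by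
    rw [Module.End.hasEigenvalue_iff_mem_spectrum, Matrix.spectrum_toLin']
    exact hA.eigenvalues_mem_spectrum_real v
  obtain ⟨u, hu⟩ := eigenvalue_mem_ball hv
  rw [Metric.mem_closedBall, Real.dist_eq, adjMatrix_apply, if_neg (G.irrefl), sub_zero] at hu
  calc _ ≤ ∑ w ∈ Finset.univ.erase u, ‖G.adjMatrix ℝ u w‖ := hu
    _ ≤ ∑ w, ‖G.adjMatrix ℝ u w‖ :=
      Finset.sum_le_sum_of_subset_of_nonneg (Finset.subset_univ _) fun _ _ _ => norm_nonneg _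
    _ = G.degree u := by
      simp [adjMatrix_apply, apply_ite, ← neighborFinset_eq_filter]
    _ ≤ d := by exact_mod_cast hG u

lemma card_not_isDeep_le (n m d : ℕ) [DecidablePred fun v : Fin n × Fin m × Bool => ¬ IsDeep d v] :
    (Finset.univ.filter fun v : Fin n × Fin m × Bool => ¬ IsDeep d v).card ≤ 4 * d * (n + m) := by
  have side (l : ℕ) : (Finset.univ.filter fun i : Fin l => (i : ℕ) < d ∨ l ≤ i + d).card ≤ 2 * d := by
    rw [Finset.filter_or]
    refine (Finset.card_union_le _ _).trans ?_
    have h₁ : (Finset.univ.filter fun i : Fin l => (i : ℕ) < d).card ≤ (Finset.range d).card :=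
      Finset.card_le_card_of_injOn (fun i => (i : ℕ)) (fun i hi => by simpa using hi)
        fun i _ j _ h => Fin.ext h
    have h₂ : (Finset.univ.filter fun i : Fin l => l ≤ i + d).card ≤ (Finset.range d).card :=
      Finset.card_le_card_of_injOn (fun i => l - 1 - (i : ℕ))
        (fun i hi => by simp at hi ⊢; lia)
        fun i _ j _ h => Fin.ext (by simp only at h; lia)
    rw [Finset.card_range] at h₁ h₂
    lia
  let S (l : ℕ) : Finset (Fin l) := Finset.univ.filter fun i : Fin l => (i : ℕ) < d ∨ l ≤ i + d
  have sub : (Finset.univ.filter fun v : Fin n × Fin m × Bool => ¬ IsDeep d v) ⊆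
      S n ×ˢ Finset.univ ∪ Finset.univ ×ˢ (S m ×ˢ Finset.univ) := by
    rintro ⟨i, j, s⟩ h
    have h' : ¬ IsDeep d (i, j, s) := (Finset.mem_filter.1 h).2
    simp only [IsDeep] at h'
    simp only [Finset.mem_filter, Finset.mem_univ, true_and, Finset.mem_union,
      Finset.mem_product, and_true, S]
    lia
  refine (Finset.card_le_card sub).trans ((Finset.card_union_le _ _).trans ?_)
  simp only [Finset.card_product, Finset.card_univ, Fintype.card_prod, Fintype.card_fin,
    Fintype.card_bool]
  have hn : (S n).card ≤ 2 * d := side n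
  have hm : (S m).card ≤ 2 * d := side m
  calc _ ≤ 2 * d * (m * 2) + n * (2 * d * 2) := by gcongr
    _ = _ := by ring

lemma abs_trace_adjMatrix_pow_sub_le (n m k : ℕ) [DecidableRel (hexFree n m).Adj] :
    |((hexFree n m).adjMatrix ℝ ^ (2 * k)).trace - hexMoment k * (2 * n * m)| ≤
      (3 ^ (2 * k) + |hexMoment k|) * (4 * (2 * k) * (n + m)) := by
  classical
  set P := (hexFree n m).adjMatrix ℝ ^ (2 * k) with hP
  have e : P.trace - hexMoment k * (2 * n * m) = ∑ v, (P v v - hexMoment k) := by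
    simp only [Finset.sum_sub_distrib, Matrix.trace, Matrix.diag_apply, Finset.sum_const,
      Finset.card_univ, Fintype.card_prod, Fintype.card_fin, Fintype.card_bool, nsmul_eq_mul]
    push_cast
    ring
  rw [e]
  calc _ ≤ ∑ v, |P v v - hexMoment k| := Finset.abs_sum_le_sum_abs _ _
    _ ≤ ∑ v, if ¬ IsDeep (2 * k) v then 3 ^ (2 * k) + |hexMoment k| else 0 := by
      refine Finset.sum_le_sum fun v _ => ?_
      by_cases hv : IsDeep (2 * k) v
      · rw [hP, adjMatrix_pow_apply_self_of_isDeep k v hv, sub_self, abs_zero, if_neg (not_not.2 hv)]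
      · rw [if_pos hv]
        exact (abs_sub _ _).trans (add_le_add_left (abs_adjMatrix_pow_apply_le _ _ _) _)
    _ = (3 ^ (2 * k) + |hexMoment k|) *
        (Finset.univ.filter fun v : Fin n × Fin m × Bool => ¬ IsDeep (2 * k) v).card := by
      rw [← Finset.sum_filter, Finset.sum_const, nsmul_eq_mul, mul_comm]
    _ ≤ _ := by
      gcongr
      exact_mod_cast card_not_isDeep_le n m (2 * k)

/-- The average over the spectrum of `H^f(n,m)` of a function of the squared eigenvalues. -/
noncomputable def spectralMean (f : ℝ → ℝ) (p : ℕ × ℕ) : ℝ :=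
  (∑ v, f (graphEigenvalues (hexFree p.1 p.2) v ^ 2)) / (2 * (p.1 : ℝ) * (p.2 : ℝ))

lemma tendsto_spectralMean_pow (k : ℕ) :
    Tendsto (spectralMean fun s => s ^ k) (atTop ×ˢ atTop) (nhds (hexMoment k)) := by
  rw [tendsto_iff_dist_tendsto_zero]
  set C : ℝ := (3 ^ (2 * k) + |hexMoment k|) * (4 * k)
  have lim : Tendsto (fun p : ℕ × ℕ => C * (1 / (p.2 : ℝ) + 1 / (p.1 : ℝ))) (atTop ×ˢ atTop)
      (nhds 0) := by
    simpa using ((tendsto_one_div_atTop_nhds_zero_nat (𝕜 := ℝ)).comp tendsto_snd |>.add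
      ((tendsto_one_div_atTop_nhds_zero_nat (𝕜 := ℝ)).comp tendsto_fst)).const_mul C
  refine squeeze_zero' (.of_forall fun _ => dist_nonneg) ?_ lim
  filter_upwards [(eventually_gt_atTop 0).prod_mk (eventually_gt_atTop 0)] with ⟨n, m⟩ ⟨hn, hm⟩
  have hn' : (0 : ℝ) < n := by exact_mod_cast hn
  have hm' : (0 : ℝ) < m := by exact_mod_cast hm
  let := Classical.decRel (hexFree n m).Adj
  have tr : ∑ v, (graphEigenvalues (hexFree n m) v ^ 2) ^ k =
      ((hexFree n m).adjMatrix ℝ ^ (2 * k)).trace := by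
    simp only [← pow_mul]
    exact (adjMatrix_isHermitian (hexFree n m)).sum_eigenvalues_pow (2 * k)
  have hN : (0 : ℝ) < 2 * n * m := by positivity
  have bound := abs_trace_adjMatrix_pow_sub_le n m k
  rw [Real.dist_eq, spectralMean, tr, div_sub' hN.ne', abs_div, abs_of_pos hN, div_le_iff₀ hN,
    mul_comm (2 * (n : ℝ) * m)]
  refine bound.trans (le_of_eq ?_)
  simp only [C]
  field_simp

lemma continuous_comp_hexSymbol {f : ℝ → ℝ} (hf : Continuous f) :
    Continuous (Function.uncurry fun x y => f (hexSymbol x y)) :=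
  hf.comp continuous_hexSymbol

lemma spectralMean_add (f g : ℝ → ℝ) (p : ℕ × ℕ) :
    spectralMean (fun s => f s + g s) p = spectralMean f p + spectralMean g p := by
  simp only [spectralMean, Finset.sum_add_distrib, add_div]

lemma spectralMean_const_mul (c : ℝ) (f : ℝ → ℝ) (p : ℕ × ℕ) :
    spectralMean (fun s => c * f s) p = c * spectralMean f p := by
  simp only [spectralMean, ← Finset.mul_sum, mul_div_assoc]

lemma tendsto_spectralMean_polynomial (q : Polynomial ℝ) :
    Tendsto (spectralMean fun s => q.eval s) (atTop ×ˢ atTop)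
      (nhds (torusMean fun x y => q.eval (hexSymbol x y))) := by
  induction q using Polynomial.induction_on' with
  | add p q hp hq =>
    simp only [Polynomial.eval_add]
    rw [torusMean_add (continuous_comp_hexSymbol p.continuous)
      (continuous_comp_hexSymbol q.continuous)]
    exact (hp.add hq).congr fun p => (spectralMean_add _ _ p).symm
  | monomial k c =>
    simp only [Polynomial.eval_monomial]
    rw [torusMean_const_mul]
    exact ((tendsto_spectralMean_pow k).const_mul c).congr
      fun p => (spectralMean_const_mul _ _ p).symm

lemma abs_spectralMean_sub_le {f g : ℝ → ℝ} {ε : ℝ} (hε : 0 ≤ ε)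
    (h : ∀ s ∈ Set.Icc (0 : ℝ) 9, |f s - g s| ≤ ε) (p : ℕ × ℕ) :
    |spectralMean f p - spectralMean g p| ≤ ε := by
  let := Classical.decRel (hexFree p.1 p.2).Adj
  rw [spectralMean, spectralMean, ← sub_div, ← Finset.sum_sub_distrib, abs_div,
    abs_of_nonneg (by positivity : (0 : ℝ) ≤ 2 * p.1 * p.2)]
  refine div_le_of_le_mul₀ (by positivity) hε ((Finset.abs_sum_le_sum_abs _ _).trans ?_)
  refine (Finset.sum_le_card_nsmul _ _ ε fun v _ => h _ ⟨sq_nonneg _, ?_⟩).trans (le_of_eq ?_)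
  · have hv : |graphEigenvalues (hexFree p.1 p.2) v| ≤ (3 : ℕ) :=
      abs_eigenvalues_adjMatrix_le hexFree_degree_le v
    rw [← sq_abs]
    calc _ ≤ ((3 : ℕ) : ℝ) ^ 2 := by gcongr
      _ = 9 := by norm_num
  · simp only [Finset.card_univ, Fintype.card_prod, Fintype.card_fin, Fintype.card_bool,
      nsmul_eq_mul]
    push_cast
    ring

lemma abs_torusMean_hexSymbol_sub_le {f g : ℝ → ℝ} (hf : Continuous f) (hg : Continuous g) {ε : ℝ}
    (h : ∀ s ∈ Set.Icc (0 : ℝ) 9, |f s - g s| ≤ ε) :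
    |torusMean (fun x y => f (hexSymbol x y)) - torusMean (fun x y => g (hexSymbol x y))| ≤ ε := by
  have e := torusMean_add (continuous_comp_hexSymbol (hf.sub hg)) (continuous_comp_hexSymbol hg)
  simp only [Pi.sub_apply, sub_add_cancel] at e
  rw [e, add_sub_cancel_right]
  exact abs_torusMean_le fun x y => h _ (hexSymbol_mem_Icc x y)

lemma tendsto_spectralMean {f : ℝ → ℝ} (hf : Continuous f) :
    Tendsto (spectralMean f) (atTop ×ˢ atTop)
      (nhds (torusMean fun x y => f (hexSymbol x y))) := by
  rw [Metric.tendsto_nhds]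
  intro ε hε
  obtain ⟨q, hq⟩ := exists_polynomial_near_of_continuousOn 0 9 f hf.continuousOn (ε / 3)
    (by positivity)
  have hq' : ∀ s ∈ Set.Icc (0 : ℝ) 9, |q.eval s - f s| ≤ ε / 3 := fun s hs => (hq s hs).le
  have h₂ := abs_le.1 (abs_torusMean_hexSymbol_sub_le q.continuous hf hq')
  filter_upwards [Metric.tendsto_nhds.1 (tendsto_spectralMean_polynomial q) (ε / 3)
    (by positivity)] with p hp
  have h₁ := abs_le.1 (abs_spectralMean_sub_le (by positivity) hq' p)
  rw [Real.dist_eq, abs_lt] at hp ⊢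
  constructor <;> linarith [hp.1, hp.2, h₁.1, h₁.2, h₂.1, h₂.2]

/-- the energy per vertex of the free-boundary hexagonal lattice
converges, as `n, m → ∞` jointly, to
`(1/(4π²)) ∫₀^{2π} ∫₀^{2π} sqrt(3 + 2cos x + 2cos y + 2cos(x+y)) dx dy`
(the same value as for the toroidal boundary condition). -/
theorem energy_per_vertex_hexFree :
    Tendsto (fun p : ℕ × ℕ => graphEnergy (hexFree p.1 p.2) / (2 * (p.1 : ℝ) * (p.2 : ℝ)))
      (atTop ×ˢ atTop)
      (nhds ((1 / (4 * π ^ 2)) *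
        ∫ x in (0:ℝ)..2 * π, ∫ y in (0:ℝ)..2 * π,
          Real.sqrt (3 + 2 * Real.cos x + 2 * Real.cos y + 2 * Real.cos (x + y)))) := by

  refine (tendsto_spectralMean Real.continuous_sqrt).congr fun p => ?_
  simp only [spectralMean, graphEnergy, Real.sqrt_sq_eq_abs]
end
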